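/- arXiv:1702.00427 — 6 statements merged into one kernel-verified Lean document; each statement's English description precedes it below -/
import Mathlib

section
/- (Lemma 2.1, asymptotics of B(s).) For every fixed positive integer n there is a constant C > 0 such that for all integers s ≥ 2, | B(s) − H(2H−1) · n · (s+n)^{2H−2} | ≤ C · n (s+n)^{2H−2} / s; in particular B(s) = H(2H−1) n (s+n)^{2H−2} (1 + O(1/s)) as s → ∞. -/
open MeasureTheory ProbabilityTheory Filter Matrix Real

noncomputable section

/-- Covariance function of fractional Gaussian noise with Hurst parameter `H`:
`b 0 = 1` and `b t = ((t+1)^{2H} - 2 t^{2H} + (t-1)^{2H})/2` for `t ≥ 1`. -/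
def covb (H : ℝ) : ℕ → ℝ
  | 0 => 1
  | (t+1) => (((t : ℝ) + 2) ^ (2*H) - 2 * ((t : ℝ) + 1) ^ (2*H) + (t : ℝ) ^ (2*H)) / 2

/-- The `k × k` symmetric Toeplitz matrix `Σ₂₂(k)` with `(i,j)` entry `b(|i-j|)`. -/
def Sigma22 (H : ℝ) (k : ℕ) : Matrix (Fin k) (Fin k) ℝ :=
  Matrix.of fun i j => covb H (Nat.dist i.1 j.1)

/-- `B(s) = ∑_{i=s}^{n+s-1} b(i)`. -/
def Bfun (H : ℝ) (n s : ℕ) : ℝ := ∑ i ∈ Finset.Ico s (n + s), covb H i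

/-- The vector `B(n,k) ∈ ℝ^k` with entries `B(1), …, B(k)`. -/
def Bvec (H : ℝ) (n k : ℕ) : Fin k → ℝ := fun s => Bfun H n (s.1 + 1)

/-- The quadratic form `B(n,k)ᵀ Σ₂₂(k)⁻¹ B(n,k)`. -/
def quadForm (H : ℝ) (n k : ℕ) : ℝ :=
  dotProduct (Bvec H n k) ((Sigma22 H k)⁻¹.mulVec (Bvec H n k))

/-- `σ²(n,k) = ∑_{i,j=1}^n b(|i-j|) - B(n,k)ᵀ Σ₂₂(k)⁻¹ B(n,k)`. -/
def sigma2 (H : ℝ) (n k : ℕ) : ℝ :=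
  (∑ i ∈ Finset.range n, ∑ j ∈ Finset.range n, covb H (Nat.dist i j)) - quadForm H n k

/-- Partial sums `S_n = X_1 + ⋯ + X_n`. -/
def partialSum {Ω : Type*} (X : ℕ → Ω → ℝ) (n : ℕ) (ω : Ω) : ℝ :=
  ∑ i ∈ Finset.range n, X (i+1) ω

/-- Standard normal density. -/
def stdGauss (x : ℝ) : ℝ := (Real.sqrt (2 * Real.pi))⁻¹ * Real.exp (- x^2 / 2)

/-- The σ-algebra generated by `X_m`, `m > n`. -/
def tailAlg {Ω : Type*} (X : ℕ → Ω → ℝ) (n : ℕ) : MeasurableSpace Ω :=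
  ⨆ m, ⨆ _ : n < m, MeasurableSpace.comap (X m) inferInstance

/-- The covariance `b(t+1)` is a second difference, so two applications of the mean value theorem
express it through the second derivative of `x ↦ x ^ (2H) / 2`. -/
lemma exists_covb_succ_eq (H : ℝ) (t : ℕ) (ht : 1 ≤ t) :
    ∃ ξ : ℝ, (t : ℝ) ≤ ξ ∧ ξ ≤ t + 2 ∧
      covb H (t + 1) = H * (2 * H - 1) * ξ ^ (2 * H - 2) := by
  have ht' : (1 : ℝ) ≤ t := by exact_mod_cast ht
  have hderiv (p x : ℝ) (hx : 1 ≤ x) :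
      HasDerivAt (fun y : ℝ => y ^ p) (p * x ^ (p - 1)) x :=
    Real.hasDerivAt_rpow_const (Or.inl (by linarith))
  have hdiff (x : ℝ) (hx : 1 ≤ x) :
      HasDerivAt (fun y : ℝ => (y + 1) ^ (2 * H) - y ^ (2 * H))
        (2 * H * (x + 1) ^ (2 * H - 1) - 2 * H * x ^ (2 * H - 1)) x :=
    ((hderiv (2 * H) (x + 1) (by linarith)).comp_add_const x 1).sub (hderiv (2 * H) x hx)
  obtain ⟨η, ⟨hη₁, hη₂⟩, hη⟩ := exists_hasDerivAt_eq_slope _ _ (lt_add_one (t : ℝ))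
    (fun x hx => (hdiff x (ht'.trans hx.1)).continuousAt.continuousWithinAt)
    (fun x hx => hdiff x (ht'.trans hx.1.le))
  have hη' : 1 ≤ η := ht'.trans hη₁.le
  obtain ⟨ξ, ⟨hξ₁, hξ₂⟩, hξ⟩ := exists_hasDerivAt_eq_slope _ _ (lt_add_one η)
    (fun x hx => (hderiv (2 * H - 1) x (hη'.trans hx.1)).continuousAt.continuousWithinAt)
    (fun x hx => hderiv (2 * H - 1) x (hη'.trans hx.1.le))
  refine ⟨ξ, by linarith, by linarith, ?_⟩
  have h₂ : (t : ℝ) + 1 + 1 = t + 2 := by ring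
  have h₁ : 2 * H - 1 - 1 = 2 * H - 2 := by ring
  rw [add_sub_cancel_left, div_one] at hη hξ
  rw [h₂] at hη
  rw [h₁] at hξ
  rw [covb]
  linear_combination (-1 / 2) * hη - H * hξ

/-- For an exponent `p ≥ -1`, moving the base from `y` down to `x` increases the `p`-th power by a
factor of at most `y / x`. -/
lemma rpow_le_div_mul_rpow {p x y : ℝ} (hp : -1 ≤ p) (hx : 0 < x) (hxy : x ≤ y) :
    x ^ p ≤ y / x * y ^ p := by
  have hy : 0 < y := hx.trans_le hxy
  have h : x ^ (p + 1) ≤ y ^ (p + 1) := Real.rpow_le_rpow hx.le hxy (by linarith)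
  rw [Real.rpow_add_one hx.ne', Real.rpow_add_one hy.ne'] at h
  rw [div_mul_eq_mul_div, le_div_iff₀ hx]
  linarith

/-- Each covariance summed in `B(s)` is close to `H(2H-1)(s+n)^{2H-2}`. -/
lemma abs_covb_sub_le (H : ℝ) (hH : 1/2 < H) (hH1 : H < 1) {n s i : ℕ} (hs : 2 ≤ s)
    (hsi : s ≤ i) (hi : i < n + s) :
    |covb H i - H * (2 * H - 1) * ((s : ℝ) + n) ^ (2 * H - 2)|
      ≤ H * (2 * H - 1) * (2 * (n + 1)) * ((s : ℝ) + n) ^ (2 * H - 2) / s := by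
  obtain ⟨t, rfl⟩ : ∃ t, i = t + 1 := ⟨i - 1, by omega⟩
  obtain ⟨ξ, hξ₁, hξ₂, hξ⟩ := exists_covb_succ_eq H t (by omega)
  have hs' : (2 : ℝ) ≤ s := by exact_mod_cast hs
  have hst : (s : ℝ) ≤ t + 1 := by exact_mod_cast hsi
  have htn : (t : ℝ) + 2 ≤ s + n := by
    have : t + 2 ≤ s + n := by omega
    exact_mod_cast this
  have hc : 0 < H * (2 * H - 1) := mul_pos (by linarith) (by linarith)
  have hξ₀ : 0 < ξ := by linarith
  have hξn : ξ ≤ s + n := hξ₂.trans htn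
  have hP : 0 < ((s : ℝ) + n) ^ (2 * H - 2) := Real.rpow_pos_of_pos (by linarith) _
  have hlower : ((s : ℝ) + n) ^ (2 * H - 2) ≤ ξ ^ (2 * H - 2) :=
    Real.rpow_le_rpow_of_nonpos hξ₀ hξn (by linarith)
  have hratio : ((s : ℝ) + n) / ξ ≤ 1 + 2 * (n + 1) / s := by
    have hn : (0 : ℝ) ≤ n := n.cast_nonneg
    rw [div_le_iff₀ hξ₀, one_add_div (by linarith), div_mul_eq_mul_div,
      le_div_iff₀ (by linarith)]
    nlinarith [mul_nonneg hn (sub_nonneg.2 hs'),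
      mul_le_mul_of_nonneg_left (show (s : ℝ) - 1 ≤ ξ by linarith)
        (show (0 : ℝ) ≤ s + 2 * (n + 1) by linarith)]
  have hupper : ξ ^ (2 * H - 2) ≤ (1 + 2 * (n + 1) / s) * ((s : ℝ) + n) ^ (2 * H - 2) :=
    (rpow_le_div_mul_rpow (by linarith) hξ₀ hξn).trans
      (mul_le_mul_of_nonneg_right hratio hP.le)
  rw [hξ, ← mul_sub, abs_of_nonneg (mul_nonneg hc.le (sub_nonneg.2 hlower))]
  calc H * (2 * H - 1) * (ξ ^ (2 * H - 2) - ((s : ℝ) + n) ^ (2 * H - 2))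
      ≤ H * (2 * H - 1) * (2 * (n + 1) / s * ((s : ℝ) + n) ^ (2 * H - 2)) :=
        mul_le_mul_of_nonneg_left (by linarith) hc.le
    _ = _ := by ring

/-- Lemma 2.1: asymptotics of `B(s)`. For every fixed `n ≥ 1` there is `C > 0` such that
for all `s ≥ 2`, `|B(s) - H(2H-1) n (s+n)^{2H-2}| ≤ C n (s+n)^{2H-2} / s`;
in particular `B(s) = H(2H-1) n (s+n)^{2H-2} (1 + O(1/s))` as `s → ∞`. -/
theorem Bfun_asymptotics
    (H : ℝ) (hH : 1/2 < H) (hH1 : H < 1) (n : ℕ) (hn : 1 ≤ n) :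
    ∃ C : ℝ, 0 < C ∧ ∀ s : ℕ, 2 ≤ s →
      |Bfun H n s - H * (2 * H - 1) * (n : ℝ) * ((s : ℝ) + (n : ℝ)) ^ (2 * H - 2)|
        ≤ C * (n : ℝ) * ((s : ℝ) + (n : ℝ)) ^ (2 * H - 2) / (s : ℝ) := by
  have hc : 0 < H * (2 * H - 1) := mul_pos (by linarith) (by linarith)
  refine ⟨H * (2 * H - 1) * (2 * (n + 1)), by positivity, fun s hs => ?_⟩
  have hsum : Bfun H n s - H * (2 * H - 1) * (n : ℝ) * ((s : ℝ) + n) ^ (2 * H - 2)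
      = ∑ i ∈ Finset.Ico s (n + s),
        (covb H i - H * (2 * H - 1) * ((s : ℝ) + n) ^ (2 * H - 2)) := by
    rw [Finset.sum_sub_distrib, Finset.sum_const, Nat.card_Ico, Nat.add_sub_cancel, nsmul_eq_mul,
      Bfun]
    ring
  rw [hsum]
  refine (Finset.abs_sum_le_sum_abs _ _).trans ((Finset.sum_le_card_nsmul _ _ _ fun i hi =>
    abs_covb_sub_le H hH hH1 hs (Finset.mem_Ico.1 hi).1 (Finset.mem_Ico.1 hi).2).trans_eq ?_)
  rw [Nat.card_Ico, Nat.add_sub_cancel, nsmul_eq_mul]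
  ring
end
end

section
/- (Corollary of Lemma 2.1, square-sum bound.) There exists a constant C > 0 depending only on H such that for all positive integers n and k, Σ_{s=1}^{k} B(s)² ≤ C · n² · (k+n)^{4H−3}. -/
open MeasureTheory ProbabilityTheory Filter Matrix Real

noncomputable section

lemma covb_nonneg_and_le {H : ℝ} (hH : 1 / 2 ≤ H) (hH1 : H ≤ 1) {i : ℕ} (hi : 1 ≤ i) :
    0 ≤ covb H i ∧ covb H i ≤ (i : ℝ) ^ (2 * H - 2) := by
  obtain ⟨t, rfl⟩ : ∃ t, i = t + 1 := ⟨i - 1, by omega⟩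
  have ht : (0 : ℝ) ≤ t := t.cast_nonneg
  simp only [covb]
  push_cast
  set y : ℝ := (t : ℝ) + 1 with hy
  have hy0 : 0 < y := by positivity
  have hx0 : 0 < y⁻¹ := by positivity
  have hx1 : y⁻¹ ≤ 1 := inv_le_one_of_one_le₀ (by linarith)
  have hplus : ((t : ℝ) + 2) ^ (2 * H) = y ^ (2 * H) * (1 + y⁻¹) ^ (2 * H) := by
    rw [← mul_rpow hy0.le (by linarith), mul_add, mul_inv_cancel₀ hy0.ne']
    congr 1
    rw [hy]
    ring
  have hminus : (t : ℝ) ^ (2 * H) = y ^ (2 * H) * (1 + -y⁻¹) ^ (2 * H) := by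
    rw [← mul_rpow hy0.le (by linarith), mul_add, mul_neg, mul_inv_cancel₀ hy0.ne']
    congr 1
    rw [hy]
    ring
  have hpow : y ^ (2 * H - 2) = y ^ (2 * H) * (y⁻¹) ^ 2 := by
    rw [rpow_sub hy0, rpow_two, inv_pow, div_eq_mul_inv]
  have lower (x : ℝ) (hx : -1 ≤ x) : 1 + 2 * H * x ≤ (1 + x) ^ (2 * H) :=
    one_add_mul_self_le_rpow_one_add hx (by linarith)
  have upper (x : ℝ) (hx : -1 ≤ x) :
      (1 + x) ^ (2 * H) ≤ (1 + x) * (1 + (2 * H - 1) * x) := by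
    have hsplit : (1 + x) ^ (2 * H) = (1 + x) * (1 + x) ^ (2 * H - 1) := by
      rw [← rpow_one_add' (by linarith) (by linarith)]
      congr 1
      ring
    rw [hsplit]
    exact mul_le_mul_of_nonneg_left
      (rpow_one_add_le_one_add_mul_self hx (by linarith) (by linarith)) (by linarith)
  have hp := lower y⁻¹ (by linarith)
  have hm := lower (-y⁻¹) (by linarith)
  have hp' := upper y⁻¹ (by linarith)
  have hm' := upper (-y⁻¹) (by linarith)
  have hY : 0 < y ^ (2 * H) := by positivity
  rw [hplus, hminus, hpow]
  constructor
  · have := mul_nonneg hY.le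
      (by linarith : 0 ≤ (1 + y⁻¹) ^ (2 * H) - 2 + (1 + -y⁻¹) ^ (2 * H))
    linarith
  · have hle : (1 + y⁻¹) ^ (2 * H) - 2 + (1 + -y⁻¹) ^ (2 * H) ≤ 2 * (y⁻¹) ^ 2 := by
      nlinarith [sq_nonneg y⁻¹]
    have := mul_le_mul_of_nonneg_left hle hY.le
    linarith

lemma Bfun_nonneg_and_le {H : ℝ} (hH : 1 / 2 ≤ H) (hH1 : H ≤ 1) (n : ℕ) {s : ℕ} (hs : 1 ≤ s) :
    0 ≤ Bfun H n s ∧ Bfun H n s ≤ n * (s : ℝ) ^ (2 * H - 2) := by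
  have hs0 : (0 : ℝ) < s := by exact_mod_cast hs
  constructor
  · exact Finset.sum_nonneg fun i hi =>
      (covb_nonneg_and_le hH hH1 (hs.trans (Finset.mem_Ico.mp hi).1)).1
  · have hterm : ∀ i ∈ Finset.Ico s (n + s), covb H i ≤ (s : ℝ) ^ (2 * H - 2) := fun i hi => by
      have hsi := (Finset.mem_Ico.mp hi).1
      exact (covb_nonneg_and_le hH hH1 (hs.trans hsi)).2.trans
        (rpow_le_rpow_of_nonpos hs0 (by exact_mod_cast hsi) (by linarith))
    simpa [Bfun] using Finset.sum_le_card_nsmul _ _ _ hterm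

lemma sum_Icc_rpow_sub_one_le {q : ℝ} (hq : 0 < q) (hq1 : q ≤ 1) (k : ℕ) :
    ∑ s ∈ Finset.Icc 1 k, (s : ℝ) ^ (q - 1) ≤ q⁻¹ * (k : ℝ) ^ q := by
  induction k with
  | zero => simp [hq.ne']
  | succ k ih =>
    rw [Finset.sum_Icc_succ_top (by omega)]
    push_cast
    set y : ℝ := (k : ℝ) + 1 with hy
    have hk : (0 : ℝ) ≤ k := k.cast_nonneg
    have hy0 : 0 < y := by positivity
    have hx1 : y⁻¹ ≤ 1 := inv_le_one_of_one_le₀ (by linarith)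
    have hkq : (k : ℝ) ^ q = y ^ q * (1 + -y⁻¹) ^ q := by
      rw [← mul_rpow hy0.le (by linarith), mul_add, mul_neg, mul_inv_cancel₀ hy0.ne']
      congr 1
      rw [hy]
      ring
    have hstep : (k : ℝ) ^ q ≤ y ^ q * (1 + q * -y⁻¹) := by
      rw [hkq]
      exact mul_le_mul_of_nonneg_left
        (rpow_one_add_le_one_add_mul_self (by linarith) hq.le hq1) (by positivity)
    calc _ ≤ q⁻¹ * (y ^ q * (1 + q * -y⁻¹)) + y ^ (q - 1) := by
          gcongr
          exact ih.trans (mul_le_mul_of_nonneg_left hstep (by positivity))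
      _ = q⁻¹ * y ^ q := by
          rw [rpow_sub_one hy0.ne']
          field_simp
          ring

/-- Corollary of Lemma 2.1: there is `C > 0` depending only on `H` such that for all
positive integers `n` and `k`, `∑_{s=1}^k B(s)² ≤ C n² (k+n)^{4H-3}`. -/
theorem Bfun_sq_sum_bound
    (H : ℝ) (hH : 3/4 < H) (hH1 : H < 1) :
    ∃ C : ℝ, 0 < C ∧ ∀ n k : ℕ, 1 ≤ n → 1 ≤ k →
      ∑ s ∈ Finset.Icc 1 k, (Bfun H n s) ^ 2
        ≤ C * (n : ℝ) ^ 2 * ((k : ℝ) + (n : ℝ)) ^ (4 * H - 3) := by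
  have hq : 0 < 4 * H - 3 := by linarith
  refine ⟨(4 * H - 3)⁻¹, by positivity, fun n k _ _ => ?_⟩
  calc ∑ s ∈ Finset.Icc 1 k, (Bfun H n s) ^ 2
      ≤ ∑ s ∈ Finset.Icc 1 k, (n : ℝ) ^ 2 * (s : ℝ) ^ (4 * H - 3 - 1) := by
        refine Finset.sum_le_sum fun s hs => ?_
        obtain ⟨h0, hle⟩ := Bfun_nonneg_and_le (H := H) (by linarith) hH1.le n
          (Finset.mem_Icc.mp hs).1
        refine (pow_le_pow_left₀ h0 hle 2).trans_eq ?_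
        rw [mul_pow, ← rpow_mul_natCast (Nat.cast_nonneg s)]
        congr 2
        push_cast
        ring
    _ = (n : ℝ) ^ 2 * ∑ s ∈ Finset.Icc 1 k, (s : ℝ) ^ (4 * H - 3 - 1) := by
        rw [Finset.mul_sum]
    _ ≤ (n : ℝ) ^ 2 * ((4 * H - 3)⁻¹ * ((k : ℝ) + n) ^ (4 * H - 3)) := by
        gcongr
        refine (sum_Icc_rpow_sub_one_le hq (by linarith) k).trans ?_
        gcongr
        simp
    _ = _ := by ring
end
end

section
/- (Lemma 2.2, uniform lower bound on the smallest eigenvalue.) There exists a constant c > 0 such that for every positive integer k, the smallest eigenvalue of the k×k Toeplitz matrix Σ₂₂(k) is at least c; in particular Σ₂₂(k) is positive definite for every k, and the smallest eigenvalues λ_min(Σ₂₂(k)) converge, as k → ∞, to a positive limit (the essential infimum of the spectral density of the process). -/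
open MeasureTheory ProbabilityTheory Filter Matrix Real

noncomputable section

/-- The smallest eigenvalue of `Σ₂₂(k)`, as the infimum of the Rayleigh quotient over
unit vectors. -/
def lamMin (H : ℝ) (k : ℕ) : ℝ :=
  sInf {x : ℝ | ∃ v : Fin k → ℝ, (∑ i, (v i) ^ 2) = 1 ∧
    x = dotProduct v ((Sigma22 H k).mulVec v)}

/-- The forward second difference of `x ↦ x ^ p`. -/
def rpowSecondDiff (p x : ℝ) : ℝ := (x + 2) ^ p - 2 * (x + 1) ^ p + x ^ p

theorem covb_succ (H : ℝ) (t : ℕ) : covb H (t + 1) = rpowSecondDiff (2 * H) t / 2 := rfl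

theorem hasDerivAt_rpowSecondDiff (p : ℝ) {x : ℝ} (hx : 0 < x) :
    HasDerivAt (rpowSecondDiff p) (p * rpowSecondDiff (p - 1) x) x := by
  have shifted (a : ℝ) (ha : 0 ≤ a) :
      HasDerivAt (fun y : ℝ => (y + a) ^ p) (p * (x + a) ^ (p - 1)) x := by
    simpa using ((hasDerivAt_id x).add_const a).rpow_const (p := p)
      (Or.inl (by simp only [id]; positivity))
  have h := ((shifted 2 (by norm_num)).sub ((shifted 1 (by norm_num)).const_mul 2)).add
    (shifted 0 le_rfl)
  simp only [add_zero] at h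
  refine h.congr_deriv ?_
  simp only [rpowSecondDiff]
  ring

theorem continuous_rpowSecondDiff {p : ℝ} (hp : 0 ≤ p) : Continuous (rpowSecondDiff p) := by
  unfold rpowSecondDiff
  exact (((continuous_id.add continuous_const).rpow_const fun _ => Or.inr hp).sub
    (continuous_const.mul ((continuous_id.add continuous_const).rpow_const
      fun _ => Or.inr hp))).add (continuous_id.rpow_const fun _ => Or.inr hp)

theorem ConvexOn.two_mul_le_add_two {f : ℝ → ℝ} (hf : ConvexOn ℝ (Set.Ici 0) f) {x : ℝ}
    (hx : 0 ≤ x) : 2 * f (x + 1) ≤ f (x + 2) + f x := by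
  have h := hf.2 (Set.mem_Ici.2 hx) (Set.mem_Ici.2 (by linarith : 0 ≤ x + 2))
    (by norm_num : (0 : ℝ) ≤ 1 / 2) (by norm_num : (0 : ℝ) ≤ 1 / 2) (by norm_num)
  simp only [smul_eq_mul] at h
  rw [show 1 / 2 * x + 1 / 2 * (x + 2) = x + 1 by ring] at h
  linarith

theorem rpowSecondDiff_nonneg_of_one_le {p x : ℝ} (hp : 1 ≤ p) (hx : 0 ≤ x) :
    0 ≤ rpowSecondDiff p x := by
  have h := (convexOn_rpow hp).two_mul_le_add_two hx
  simp only [rpowSecondDiff]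
  linarith

theorem rpowSecondDiff_nonpos {p x : ℝ} (hp₀ : 0 ≤ p) (hp₁ : p ≤ 1) (hx : 0 ≤ x) :
    rpowSecondDiff p x ≤ 0 := by
  have h := (Real.concaveOn_rpow hp₀ hp₁).neg.two_mul_le_add_two hx
  simp only [rpowSecondDiff, Pi.neg_apply] at h ⊢
  linarith

theorem rpowSecondDiff_nonneg_of_nonpos {p x : ℝ} (hp : p ≤ 0) (hx : 0 < x) :
    0 ≤ rpowSecondDiff p x := by
  have h2 : 0 < (x + 2) ^ p := by positivity
  have h0 : 0 < x ^ p := by positivity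
  have h1 : 0 < (x + 1) ^ p := by positivity
  have h : (x + 1) ^ p * (x + 1) ^ p ≤ (x + 2) ^ p * x ^ p := by
    rw [← mul_rpow (by positivity) (by positivity), ← mul_rpow (by positivity) hx.le]
    exact rpow_le_rpow_of_nonpos (by positivity) (by nlinarith) hp
  simp only [rpowSecondDiff]
  nlinarith [sq_nonneg ((x + 2) ^ p - x ^ p)]

theorem antitoneOn_rpowSecondDiff {p : ℝ} (hp₁ : 1 ≤ p) (hp₂ : p ≤ 2) :
    AntitoneOn (rpowSecondDiff p) (Set.Ici 0) := by
  refine antitoneOn_of_hasDerivWithinAt_nonpos (f' := fun x => p * rpowSecondDiff (p - 1) x)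
    (convex_Ici 0) (continuous_rpowSecondDiff (by linarith)).continuousOn ?_ ?_ <;>
  intro x hx <;> rw [interior_Ici, Set.mem_Ioi] at hx
  · exact (hasDerivAt_rpowSecondDiff p hx).hasDerivWithinAt
  · exact mul_nonpos_of_nonneg_of_nonpos (by linarith)
      (rpowSecondDiff_nonpos (by linarith) (by linarith) hx.le)

theorem convexOn_rpowSecondDiff {p : ℝ} (hp₁ : 1 ≤ p) (hp₂ : p ≤ 2) :
    ConvexOn ℝ (Set.Ici 0) (rpowSecondDiff p) := by
  refine convexOn_of_hasDerivWithinAt2_nonneg (f' := fun x => p * rpowSecondDiff (p - 1) x)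
    (f'' := fun x => p * ((p - 1) * rpowSecondDiff (p - 1 - 1) x))
    (convex_Ici 0) (continuous_rpowSecondDiff (by linarith)).continuousOn ?_ ?_ ?_ <;>
  intro x hx <;> rw [interior_Ici, Set.mem_Ioi] at hx
  · exact (hasDerivAt_rpowSecondDiff p hx).hasDerivWithinAt
  · exact ((hasDerivAt_rpowSecondDiff (p - 1) hx).const_mul p).hasDerivWithinAt
  · exact mul_nonneg (by linarith) (mul_nonneg (by linarith)
      (rpowSecondDiff_nonneg_of_nonpos (by linarith) hx))

theorem three_rpow_sub_four_mul_two_rpow_pos {p : ℝ} (hp : p < 2) :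
    0 < (3 : ℝ) ^ p - 4 * 2 ^ p + 7 := by
  set x : ℝ := 2 ^ (p - 2) with hx
  have hx0 : 0 < x := by positivity
  have hx1 : x < 1 := rpow_lt_one_of_one_lt_of_neg (by norm_num) (by linarith)
  have h2 : (2 : ℝ) ^ p = 4 * x := by
    rw [hx, rpow_sub (by norm_num)]; norm_num; ring
  have h3 : (3 : ℝ) ^ p = 9 * 3 ^ (p - 2) := by
    rw [rpow_sub (by norm_num)]; norm_num; ring
  have hbase : (3 : ℝ) ≤ 2 ^ (16 / 9 : ℝ) := by
    refine le_of_pow_le_pow_left₀ (n := 9) (by norm_num) (by positivity) ?_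
    rw [← rpow_natCast (2 ^ (16 / 9 : ℝ)), ← rpow_mul (by norm_num)]
    norm_num
  have hpow : x ^ (16 / 9 : ℝ) ≤ 3 ^ (p - 2) := by
    rw [hx, ← rpow_mul (by norm_num), mul_comm, rpow_mul (by norm_num)]
    exact rpow_le_rpow_of_nonpos (by norm_num) hbase (by linarith)
  have hbern := one_add_mul_self_lt_rpow_one_add (s := x - 1) (by linarith) (by linarith)
    (p := 16 / 9) (by norm_num)
  rw [add_sub_cancel] at hbern
  rw [h2, h3]
  linarith

/-- A sequence is a combination of triangular functions weighted by its second differences. -/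
theorem eq_add_sum_secondDiff_mul_triangle (b : ℕ → ℝ) (n t : ℕ) (ht : t ≤ n + 1) :
    b t = b (n + 1) + (b n - b (n + 1)) * ((n + 1 - t : ℕ) : ℝ) +
      ∑ m ∈ Finset.range n, (b m - 2 * b (m + 1) + b (m + 2)) * ((m + 1 - t : ℕ) : ℝ) := by
  induction n with
  | zero => interval_cases t <;> simp
  | succ n ih =>
    rw [Finset.sum_range_succ]
    rcases Nat.lt_or_ge (n + 1) t with h | h
    · obtain rfl : t = n + 2 := by omega
      rw [Finset.sum_eq_zero]
      · simp
      · intro m hm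
        rw [Finset.mem_range] at hm
        rw [Nat.sub_eq_zero_of_le (by omega)]
        simp
    · rw [show n + 1 + 1 - t = (n + 1 - t) + 1 by omega]
      push_cast
      linear_combination ih h

theorem sum_mul_triangle_dist_nonneg {k : ℕ} (v : Fin k → ℝ) (m : ℕ) :
    0 ≤ ∑ i, ∑ j, v i * v j * ((m - Nat.dist i.1 j.1 : ℕ) : ℝ) := by
  have overlap (i j : Fin k) : ((m - Nat.dist i.1 j.1 : ℕ) : ℝ) =
      ∑ s ∈ Finset.range (k + m), (if s ∈ Finset.Ico i.1 (i.1 + m) then (1 : ℝ) else 0) *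
        (if s ∈ Finset.Ico j.1 (j.1 + m) then 1 else 0) := by
    simp only [← ite_and, mul_ite, mul_one, mul_zero, ← Finset.mem_inter,
      Finset.Ico_inter_Ico]
    rw [Finset.sum_boole, Finset.filter_mem_eq_inter, Finset.inter_eq_right.2, Nat.card_Ico]
    · congr 1
      simp only [Nat.dist]
      omega
    · intro s hs
      simp only [Finset.mem_Ico, Finset.mem_range] at hs ⊢
      omega
  have square : ∑ i, ∑ j, v i * v j * ((m - Nat.dist i.1 j.1 : ℕ) : ℝ) =
      ∑ s ∈ Finset.range (k + m),
        (∑ i, v i * if s ∈ Finset.Ico i.1 (i.1 + m) then 1 else 0) ^ 2 := by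
    simp_rw [overlap, sq, Finset.sum_mul_sum, Finset.mul_sum]
    rw [Finset.sum_comm (s := Finset.range (k + m))]
    refine Finset.sum_congr rfl fun i _ => ?_
    rw [Finset.sum_comm (s := Finset.range (k + m))]
    exact Finset.sum_congr rfl fun j _ => Finset.sum_congr rfl fun s _ => by ring
  rw [square]
  positivity

/-- Quantitative Pólya criterion: a Toeplitz form with a convex coefficient sequence,
nonnegative and nonincreasing from index `1` on, is bounded below by the first second difference. -/
theorem secondDiff_zero_mul_sum_sq_le {b : ℕ → ℝ}
    (hconv : ∀ m, 0 ≤ b m - 2 * b (m + 1) + b (m + 2))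
    (hanti : ∀ m, b (m + 2) ≤ b (m + 1)) (hnonneg : ∀ m, 0 ≤ b (m + 1)) {k : ℕ} (hk : 1 ≤ k)
    (v : Fin k → ℝ) :
    (b 0 - 2 * b 1 + b 2) * ∑ i, v i ^ 2 ≤ ∑ i, ∑ j, v i * v j * b (Nat.dist i.1 j.1) := by
  obtain ⟨k, rfl⟩ := Nat.exists_eq_add_of_le' hk
  have expand : ∑ i, ∑ j, v i * v j * b (Nat.dist i.1 j.1) =
      b (k + 2) * (∑ i, v i) ^ 2 + (b (k + 1) - b (k + 2)) *
        ∑ i, ∑ j, v i * v j * ((k + 2 - Nat.dist i.1 j.1 : ℕ) : ℝ) +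
      ∑ m ∈ Finset.range (k + 1), (b m - 2 * b (m + 1) + b (m + 2)) *
        ∑ i, ∑ j, v i * v j * ((m + 1 - Nat.dist i.1 j.1 : ℕ) : ℝ) := by
    have entry (i j : Fin (k + 1)) := eq_add_sum_secondDiff_mul_triangle b (k + 1)
      (Nat.dist i.1 j.1) (by simp only [Nat.dist]; omega)
    simp only [Finset.mul_sum (Finset.univ : Finset (Fin (k + 1)))]
    rw [Finset.sum_comm (s := Finset.range (k + 1)), sq, Finset.sum_mul_sum, Finset.mul_sum,
      ← Finset.sum_add_distrib, ← Finset.sum_add_distrib]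
    refine Finset.sum_congr rfl fun i _ => ?_
    rw [Finset.sum_comm (s := Finset.range (k + 1)), Finset.mul_sum,
      ← Finset.sum_add_distrib, ← Finset.sum_add_distrib]
    refine Finset.sum_congr rfl fun j _ => ?_
    rw [entry i j, mul_add, mul_add, Finset.mul_sum]
    refine congrArg₂ _ (by ring) (Finset.sum_congr rfl fun m _ => by ring)
  have diagonal : ∑ i, ∑ j, v i * v j * ((0 + 1 - Nat.dist i.1 j.1 : ℕ) : ℝ) = ∑ i, v i ^ 2 := by
    refine Finset.sum_congr rfl fun i _ => ?_
    rw [Finset.sum_eq_single i]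
    · simp [sq]
    · intro j _ hj
      have : i.1 ≠ j.1 := fun h => hj (Fin.ext h.symm)
      rw [Nat.sub_eq_zero_of_le (by simp only [Nat.dist]; omega)]
      simp
    · simp
  rw [expand, Finset.sum_range_succ', diagonal]
  have h₁ := mul_nonneg (hnonneg (k + 1)) (sq_nonneg (∑ i, v i))
  have h₂ := mul_nonneg (sub_nonneg.2 (hanti k)) (sum_mul_triangle_dist_nonneg v (k + 2))
  have h₃ : 0 ≤ ∑ m ∈ Finset.range k, (b (m + 1) - 2 * b (m + 1 + 1) + b (m + 1 + 2)) *
      ∑ i, ∑ j, v i * v j * ((m + 1 + 1 - Nat.dist i.1 j.1 : ℕ) : ℝ) :=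
    Finset.sum_nonneg fun m _ => mul_nonneg (hconv _) (sum_mul_triangle_dist_nonneg v _)
  simp only [zero_add] at h₁ h₂ h₃ ⊢
  linarith

theorem covb_secondDiff_zero_pos {H : ℝ} (hH : 1 / 2 < H) (hH1 : H < 1) :
    0 < covb H 0 - 2 * covb H 1 + covb H 2 := by
  have h := three_rpow_sub_four_mul_two_rpow_pos (p := 2 * H) (by linarith)
  have h0 : (0 : ℝ) ^ (2 * H) = 0 := zero_rpow (by linarith)
  simp only [covb, Nat.cast_zero, Nat.cast_one, zero_add, one_rpow, h0]
  norm_num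
  linarith

theorem dotProduct_Sigma22_mulVec (H : ℝ) {k : ℕ} (v : Fin k → ℝ) :
    v ⬝ᵥ (Sigma22 H k).mulVec v = ∑ i, ∑ j, v i * v j * covb H (Nat.dist i.1 j.1) := by
  simp only [dotProduct, mulVec, Sigma22, Matrix.of_apply, Finset.mul_sum]
  exact Finset.sum_congr rfl fun i _ => Finset.sum_congr rfl fun j _ => by ring

theorem covb_secondDiff_zero_mul_le {H : ℝ} (hH : 1 / 2 < H) (hH1 : H < 1) {k : ℕ} (hk : 1 ≤ k)
    (v : Fin k → ℝ) :
    (covb H 0 - 2 * covb H 1 + covb H 2) * ∑ i, v i ^ 2 ≤ v ⬝ᵥ (Sigma22 H k).mulVec v := by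
  rw [dotProduct_Sigma22_mulVec]
  have hp₁ : 1 ≤ 2 * H := by linarith
  have hp₂ : 2 * H ≤ 2 := by linarith
  refine secondDiff_zero_mul_sum_sq_le ?_ ?_ ?_ hk v
  · rintro (_ | m)
    · exact (covb_secondDiff_zero_pos hH hH1).le
    · have h := (convexOn_rpowSecondDiff hp₁ hp₂).two_mul_le_add_two (Nat.cast_nonneg m)
      rw [covb_succ, covb_succ, show m + 1 + 2 = m + 2 + 1 from rfl, covb_succ]
      push_cast
      linarith
  · intro m
    have h := antitoneOn_rpowSecondDiff hp₁ hp₂ (Set.mem_Ici.2 (Nat.cast_nonneg m))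
      (Set.mem_Ici.2 (Nat.cast_nonneg (m + 1))) (Nat.cast_le.2 m.le_succ)
    rw [covb_succ, covb_succ]
    linarith
  · intro m
    rw [covb_succ]
    exact div_nonneg (rpowSecondDiff_nonneg_of_one_le hp₁ (Nat.cast_nonneg m)) (by norm_num)

theorem Sigma22_posDef {H : ℝ} (hH : 1 / 2 < H) (hH1 : H < 1) {k : ℕ} (hk : 1 ≤ k) :
    (Sigma22 H k).PosDef := by
  refine .of_dotProduct_mulVec_pos ?_ fun v hv => ?_
  · ext i j
    simp [Sigma22, Nat.dist_comm]
  · obtain ⟨i, hi⟩ := Function.ne_iff.1 hv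
    have hsum : 0 < ∑ i, v i ^ 2 :=
      Finset.sum_pos' (fun _ _ => sq_nonneg _) ⟨i, Finset.mem_univ i, sq_pos_of_ne_zero hi⟩
    rw [star_trivial]
    exact (mul_pos (covb_secondDiff_zero_pos hH hH1) hsum).trans_le
      (covb_secondDiff_zero_mul_le hH hH1 hk v)

/-- The set of values of the quadratic form of `Sigma22 H k` on unit vectors. -/
def rayleighValues (H : ℝ) (k : ℕ) : Set ℝ :=
  {x : ℝ | ∃ v : Fin k → ℝ, (∑ i, (v i) ^ 2) = 1 ∧ x = dotProduct v ((Sigma22 H k).mulVec v)}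

theorem rayleighValues_succ_nonempty (H : ℝ) (k : ℕ) : (rayleighValues H (k + 1)).Nonempty :=
  ⟨_, Pi.single 0 1, by simp [Pi.single_apply], rfl⟩

theorem rayleighValues_subset_succ (H : ℝ) (k : ℕ) :
    rayleighValues H k ⊆ rayleighValues H (k + 1) := by
  rintro x ⟨v, hv, rfl⟩
  refine ⟨Fin.snoc v 0, ?_, ?_⟩
  · simpa [Fin.sum_univ_castSucc] using hv
  · simp [dotProduct_Sigma22_mulVec, Fin.sum_univ_castSucc]

theorem covb_secondDiff_zero_mem_lowerBounds {H : ℝ} (hH : 1 / 2 < H) (hH1 : H < 1) (k : ℕ) :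
    covb H 0 - 2 * covb H 1 + covb H 2 ∈ lowerBounds (rayleighValues H (k + 1)) := by
  rintro x ⟨v, hv, rfl⟩
  simpa [hv] using covb_secondDiff_zero_mul_le hH hH1 (Nat.succ_pos k) v

theorem antitone_lamMin_succ {H : ℝ} (hH : 1 / 2 < H) (hH1 : H < 1) :
    Antitone fun k => lamMin H (k + 1) :=
  antitone_nat_of_succ_le fun k => csInf_le_csInf
    ⟨_, covb_secondDiff_zero_mem_lowerBounds hH hH1 (k + 1)⟩
    (rayleighValues_succ_nonempty H k) (rayleighValues_subset_succ H (k + 1))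

theorem covb_secondDiff_zero_le_lamMin {H : ℝ} (hH : 1 / 2 < H) (hH1 : H < 1) (k : ℕ) :
    covb H 0 - 2 * covb H 1 + covb H 2 ≤ lamMin H (k + 1) :=
  le_csInf (rayleighValues_succ_nonempty H k) (covb_secondDiff_zero_mem_lowerBounds hH hH1 k)

/-- Lemma 2.2: there is `c > 0` with `λ_min(Σ₂₂(k)) ≥ c` for every `k ≥ 1`; in particular
`Σ₂₂(k)` is positive definite for every `k`, and `λ_min(Σ₂₂(k))` converges, as `k → ∞`,
to a positive limit. -/
theorem smallest_eigenvalue_bounded_below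
    (H : ℝ) (hH : 1/2 < H) (hH1 : H < 1) :
    ∃ c : ℝ, 0 < c ∧
      (∀ k : ℕ, 1 ≤ k → ∀ v : Fin k → ℝ,
        c * (∑ i, (v i) ^ 2) ≤ dotProduct v ((Sigma22 H k).mulVec v)) ∧
      (∀ k : ℕ, 1 ≤ k → (Sigma22 H k).PosDef) ∧
      (∃ l : ℝ, 0 < l ∧ Tendsto (fun k => lamMin H k) atTop (nhds l)) := by
  have hc := covb_secondDiff_zero_pos hH hH1
  have hbound := covb_secondDiff_zero_le_lamMin hH hH1
  refine ⟨_, hc, fun k hk v => covb_secondDiff_zero_mul_le hH hH1 hk v,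
    fun k hk => Sigma22_posDef hH hH1 hk, ⨅ k, lamMin H (k + 1), hc.trans_le (le_ciInf hbound), ?_⟩
  rw [← tendsto_add_atTop_iff_nat 1]
  exact tendsto_atTop_ciInf (antitone_lamMin_succ hH hH1) ⟨_, Set.forall_mem_range.2 hbound⟩
end
end

section
/- (Operator norm bound for the Toeplitz covariance matrix.) There exists a constant C > 0 depending only on H such that for every positive integer k, the spectral norm (equivalently, the largest eigenvalue) of Σ₂₂(k) satisfies ‖Σ₂₂(k)‖₂ ≤ C · k^{2H−1}. -/
open MeasureTheory ProbabilityTheory Filter Matrix Real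

noncomputable section

/-- The covariance function is nonnegative for `H ≥ 1/2`, by convexity of `x ↦ x^{2H}`. -/
lemma covb_nonneg {H : ℝ} (hH : 1 / 2 ≤ H) (t : ℕ) : 0 ≤ covb H t := by
  cases t with
  | zero => simp [covb]
  | succ t =>
    have hconv := (convexOn_rpow (p := 2 * H) (by linarith)).2
      (show (t : ℝ) ∈ Set.Ici 0 from Set.mem_Ici.mpr (Nat.cast_nonneg t))
      (show (t : ℝ) + 2 ∈ Set.Ici 0 from Set.mem_Ici.mpr (by positivity))
      (show (0 : ℝ) ≤ 1 / 2 by norm_num) (show (0 : ℝ) ≤ 1 / 2 by norm_num) (by norm_num)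
    simp only [smul_eq_mul] at hconv
    rw [show 1 / 2 * (t : ℝ) + 1 / 2 * ((t : ℝ) + 2) = t + 1 by ring] at hconv
    simp only [covb]
    linarith

/-- The partial sums of the covariance function telescope. -/
lemma two_mul_sum_range_covb {H : ℝ} (hH : 0 < H) (k : ℕ) :
    2 * ∑ t ∈ Finset.range (k + 1), covb H t
      = 1 + ((k : ℝ) + 1) ^ (2 * H) - (k : ℝ) ^ (2 * H) := by
  induction k with
  | zero =>
    have hp : 2 * H ≠ 0 := by positivity
    norm_num [covb, Real.zero_rpow hp]
  | succ k ih =>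
    rw [Finset.sum_range_succ, mul_add, ih]
    simp only [covb]
    push_cast
    rw [show (k : ℝ) + 1 + 1 = k + 2 by ring]
    ring

/-- A backward difference bound for `x ↦ x^p`, from Bernoulli's inequality. -/
lemma rpow_sub_rpow_sub_one_le {p x : ℝ} (hp : 1 ≤ p) (hx : 1 ≤ x) :
    x ^ p - (x - 1) ^ p ≤ p * x ^ (p - 1) := by
  have hx0 : 0 < x := by linarith
  have hinv : x⁻¹ ≤ 1 := inv_le_one_of_one_le₀ hx
  have hbern := one_add_mul_self_le_rpow_one_add (s := -x⁻¹) (by linarith) hp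
  have hfactor : (x - 1) ^ p = x ^ p * (1 + -x⁻¹) ^ p := by
    rw [← Real.mul_rpow hx0.le (by linarith)]
    congr 1
    field_simp
    ring
  have hmul := mul_le_mul_of_nonneg_left hbern (Real.rpow_nonneg hx0.le p)
  rw [Real.rpow_sub_one hx0.ne', hfactor]
  calc x ^ p - x ^ p * (1 + -x⁻¹) ^ p ≤ x ^ p - x ^ p * (1 + p * -x⁻¹) := by linarith
    _ = p * (x ^ p / x) := by ring

/-- Each row sum of a nonnegative symmetric Toeplitz array is at most twice the sum of its
generating sequence. -/
lemma sum_range_dist_le {f : ℕ → ℝ} (hf : ∀ t, 0 ≤ f t) {i k : ℕ} (hi : i < k) :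
    ∑ j ∈ Finset.range k, f (Nat.dist i j) ≤ 2 * ∑ t ∈ Finset.range k, f t := by
  rw [← Finset.sum_range_add_sum_Ico _ hi.le, two_mul]
  refine add_le_add ?_ ?_
  · calc ∑ j ∈ Finset.range i, f (Nat.dist i j)
        = ∑ j ∈ Finset.range i, f (i - 1 - j + 1) := by
          refine Finset.sum_congr rfl fun j hj => ?_
          have hji := Finset.mem_range.mp hj
          rw [Nat.dist_eq_sub_of_le_right hji.le]
          congr 1
          omega
      _ = ∑ j ∈ Finset.range i, f (j + 1) := Finset.sum_range_reflect (fun j => f (j + 1)) i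
      _ ≤ ∑ t ∈ Finset.range (i + 1), f t := by
          rw [Finset.sum_range_succ']
          linarith [hf 0]
      _ ≤ ∑ t ∈ Finset.range k, f t :=
          Finset.sum_le_sum_of_subset_of_nonneg (Finset.range_mono hi) fun t _ _ => hf t
  · rw [Finset.sum_Ico_eq_sum_range]
    calc ∑ j ∈ Finset.range (k - i), f (Nat.dist i (i + j))
        = ∑ j ∈ Finset.range (k - i), f j := by
          refine Finset.sum_congr rfl fun j _ => ?_
          rw [Nat.dist_eq_sub_of_le (Nat.le_add_right i j), Nat.add_sub_cancel_left]
      _ ≤ ∑ t ∈ Finset.range k, f t :=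
          Finset.sum_le_sum_of_subset_of_nonneg (Finset.range_mono (Nat.sub_le k i))
            fun t _ _ => hf t

/-- Schur's test for a matrix with nonnegative entries. -/
lemma sum_mulVec_sq_le {m n : Type*} [Fintype m] [Fintype n] {A : Matrix m n ℝ} {R S : ℝ}
    (hA : ∀ i j, 0 ≤ A i j) (hR : 0 ≤ R) (hrow : ∀ i, ∑ j, A i j ≤ R)
    (hcol : ∀ j, ∑ i, A i j ≤ S) (v : n → ℝ) :
    ∑ i, (A.mulVec v i) ^ 2 ≤ R * S * ∑ j, (v j) ^ 2 := by
  have hentry (i : m) : (A.mulVec v i) ^ 2 ≤ R * ∑ j, A i j * (v j) ^ 2 := by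
    refine (Finset.sum_sq_le_sum_mul_sum_of_sq_le_mul Finset.univ
      (r := fun j => A i j * v j) (f := fun j => A i j) (g := fun j => A i j * (v j) ^ 2)
      (fun j _ => hA i j) (fun j _ => mul_nonneg (hA i j) (sq_nonneg _))
      (fun j _ => le_of_eq (by ring))).trans ?_
    exact mul_le_mul_of_nonneg_right (hrow i)
      (Finset.sum_nonneg fun j _ => mul_nonneg (hA i j) (sq_nonneg _))
  calc ∑ i, (A.mulVec v i) ^ 2 ≤ ∑ i, R * ∑ j, A i j * (v j) ^ 2 :=
        Finset.sum_le_sum fun i _ => hentry i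
    _ = R * ∑ j, (∑ i, A i j) * (v j) ^ 2 := by
        rw [← Finset.mul_sum, Finset.sum_comm]
        simp only [Finset.sum_mul]
    _ ≤ R * ∑ j, S * (v j) ^ 2 :=
        mul_le_mul_of_nonneg_left (Finset.sum_le_sum fun j _ =>
          mul_le_mul_of_nonneg_right (hcol j) (sq_nonneg _)) hR
    _ = R * S * ∑ j, (v j) ^ 2 := by rw [← Finset.mul_sum, mul_assoc]

/-- The row sums of `Σ₂₂(k)` are at most `(1 + 2H) k^{2H-1}`. -/
lemma sum_Sigma22_row_le {H : ℝ} (hH : 1 / 2 ≤ H) {k : ℕ} (i : Fin k) :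
    ∑ j, Sigma22 H k i j ≤ (1 + 2 * H) * (k : ℝ) ^ (2 * H - 1) := by
  obtain ⟨n, rfl⟩ : ∃ n, k = n + 1 := ⟨k - 1, by have := i.2; omega⟩
  have hone : (1 : ℝ) ≤ ((n + 1 : ℕ) : ℝ) := by exact_mod_cast Nat.le_add_left 1 n
  have hdiff := rpow_sub_rpow_sub_one_le (p := 2 * H) (by linarith) hone
  have hpow := Real.one_le_rpow hone (show 0 ≤ 2 * H - 1 by linarith)
  calc ∑ j, Sigma22 H (n + 1) i j
      = ∑ j ∈ Finset.range (n + 1), covb H (Nat.dist i j) :=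
        Fin.sum_univ_eq_sum_range (fun j => covb H (Nat.dist i j)) (n + 1)
    _ ≤ 2 * ∑ t ∈ Finset.range (n + 1), covb H t := sum_range_dist_le (covb_nonneg hH) i.2
    _ = 1 + ((n : ℝ) + 1) ^ (2 * H) - (n : ℝ) ^ (2 * H) :=
        two_mul_sum_range_covb (by linarith) n
    _ ≤ (1 + 2 * H) * ((n + 1 : ℕ) : ℝ) ^ (2 * H - 1) := by
        push_cast at hdiff hpow ⊢
        rw [add_sub_cancel_right] at hdiff
        linarith

/-- Operator norm bound: there is `C > 0` depending only on `H` such that for every `k ≥ 1`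
the spectral norm of `Σ₂₂(k)` is at most `C k^{2H-1}`, i.e. `‖Σ₂₂(k) v‖ ≤ C k^{2H-1} ‖v‖`
for every `v ∈ ℝ^k` (Euclidean norms). -/
theorem Sigma22_spectral_norm_bound
    (H : ℝ) (hH : 1/2 < H) (hH1 : H < 1) :
    ∃ C : ℝ, 0 < C ∧ ∀ k : ℕ, 1 ≤ k → ∀ v : Fin k → ℝ,
      Real.sqrt (∑ i, ((Sigma22 H k).mulVec v i) ^ 2)
        ≤ C * (k : ℝ) ^ (2 * H - 1) * Real.sqrt (∑ i, (v i) ^ 2) := by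
  refine ⟨1 + 2 * H, by linarith, fun k _ v => ?_⟩
  have hR : 0 ≤ (1 + 2 * H) * (k : ℝ) ^ (2 * H - 1) :=
    mul_nonneg (by linarith) (Real.rpow_nonneg (Nat.cast_nonneg k) _)
  have hrow := fun i : Fin k => sum_Sigma22_row_le hH.le i
  have hcol (j : Fin k) : ∑ i, Sigma22 H k i j ≤ (1 + 2 * H) * (k : ℝ) ^ (2 * H - 1) := by
    simpa only [Sigma22, Matrix.of_apply, Nat.dist_comm] using hrow j
  have hschur := sum_mulVec_sq_le (A := Sigma22 H k)
    (fun i j => covb_nonneg hH.le (Nat.dist i j)) hR hrow hcol v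
  refine (Real.sqrt_le_sqrt hschur).trans_eq ?_
  rw [Real.sqrt_mul (mul_nonneg hR hR), Real.sqrt_mul_self hR]
end
end

section
/- (Lower bound on q(s) used in the proof of Lemma 2.4.) Fix a constant m > 0 and set c(k) = 1/(m k^{2H−1}) and, for 1 ≤ s ≤ k, q(s) = c(k) Σ_{i=1}^{k} (B(i)/B(s)) b(|i−s|). Then there exists a constant K > 0 depending only on H such that for all positive integers n, all sufficiently large k and all s with 4 ≤ s ≤ k−2, q(s) ≥ (K/m) · ((n+s)/k)^{2−2H}. -/
open MeasureTheory ProbabilityTheory Filter Matrix Real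

noncomputable section

/-- `q(s) = c(k) ∑_{i=1}^k (B(i)/B(s)) b(|i-s|)` with `c(k) = 1/(m k^{2H-1})`. -/
def qfun (H : ℝ) (n k : ℕ) (m : ℝ) (s : ℕ) : ℝ :=
  (1 / (m * (k : ℝ) ^ (2 * H - 1))) *
    ∑ i ∈ Finset.Icc 1 k, (Bfun H n i / Bfun H n s) * covb H (Nat.dist i s)

/-- A second difference of `x ^ p` is a value of its second derivative. -/
lemma exists_second_difference_rpow_eq {p : ℝ} (hp : 1 < p) {x : ℝ} (hx : 0 ≤ x) :
    ∃ ξ, x < ξ ∧ ξ < x + 2 ∧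
      (x + 2) ^ p - 2 * (x + 1) ^ p + x ^ p = p * (p - 1) * ξ ^ (p - 2) := by
  have hcont (c q : ℝ) (hq : 0 ≤ q) : Continuous fun y : ℝ => (y + c) ^ q :=
    (continuous_id.add continuous_const).rpow_const fun _ => Or.inr hq
  have hderiv (c q y : ℝ) (h : 0 < y + c) :
      HasDerivAt (fun y : ℝ => (y + c) ^ q) (q * (y + c) ^ (q - 1)) y := by
    simpa using ((hasDerivAt_id y).add_const c).rpow_const (p := q) (Or.inl h.ne')
  obtain ⟨η, ⟨hη₁, hη₂⟩, hη⟩ := exists_hasDerivAt_eq_slope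
    (fun y : ℝ => (y + 1) ^ p - (y + 0) ^ p)
    (fun y => p * (y + 1) ^ (p - 1) - p * (y + 0) ^ (p - 1)) (lt_add_one x)
    ((hcont 1 p (by linarith)).sub (hcont 0 p (by linarith))).continuousOn
    (fun y hy => (hderiv 1 p y (by linarith [hy.1])).sub (hderiv 0 p y (by linarith [hy.1])))
  obtain ⟨ξ, ⟨hξ₁, hξ₂⟩, hξ⟩ := exists_hasDerivAt_eq_slope
    (fun y : ℝ => (y + 0) ^ (p - 1))
    (fun y => (p - 1) * (y + 0) ^ (p - 1 - 1)) (lt_add_one η)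
    (hcont 0 (p - 1) (by linarith)).continuousOn
    (fun y hy => hderiv 0 (p - 1) y (by linarith [hy.1]))
  refine ⟨ξ, by linarith, by linarith, ?_⟩
  simp only [add_zero, add_sub_cancel_left, div_one] at hη hξ
  rw [show x + 1 + 1 = x + 2 by ring] at hη
  rw [show p - 1 - 1 = p - 2 by ring] at hξ
  linear_combination -hη - p * hξ

lemma le_covb {H : ℝ} (hH : 1 / 2 < H) (hH1 : H < 1) (t : ℕ) :
    H * (2 * H - 1) * ((t : ℝ) + 1) ^ (2 * H - 2) ≤ covb H t := by
  cases t with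
  | zero => simp only [covb, Nat.cast_zero, zero_add, one_rpow]; nlinarith
  | succ t =>
    have ht : (0 : ℝ) ≤ t := t.cast_nonneg
    obtain ⟨ξ, hξ₁, hξ₂, hξ⟩ :=
      exists_second_difference_rpow_eq (p := 2 * H) (by linarith) ht
    have hle : ((t : ℝ) + 2) ^ (2 * H - 2) ≤ ξ ^ (2 * H - 2) :=
      rpow_le_rpow_of_nonpos (by linarith) hξ₂.le (by linarith)
    have hmul := mul_le_mul_of_nonneg_left hle
      (mul_nonneg (by linarith) (by linarith) : 0 ≤ H * (2 * H - 1))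
    simp only [covb, hξ]
    push_cast
    rw [show (t : ℝ) + 1 + 1 = t + 2 by ring]
    linarith

lemma covb_le {H : ℝ} (hH : 1 / 2 < H) (hH1 : H < 1) (t : ℕ) (ht : 2 ≤ t) :
    covb H t ≤ H * (2 * H - 1) * ((t : ℝ) - 1) ^ (2 * H - 2) := by
  obtain ⟨t, rfl⟩ := Nat.exists_eq_add_of_le' (show 1 ≤ t by omega)
  have ht : (1 : ℝ) ≤ t := by exact_mod_cast (show 1 ≤ t by omega)
  obtain ⟨ξ, hξ₁, hξ₂, hξ⟩ :=
    exists_second_difference_rpow_eq (p := 2 * H) (by linarith) (zero_le_one.trans ht)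
  have hle : ξ ^ (2 * H - 2) ≤ (t : ℝ) ^ (2 * H - 2) :=
    rpow_le_rpow_of_nonpos (by linarith) hξ₁.le (by linarith)
  have hmul := mul_le_mul_of_nonneg_left hle
    (mul_nonneg (by linarith) (by linarith) : 0 ≤ H * (2 * H - 1))
  simp only [covb, hξ]
  push_cast
  rw [show (t : ℝ) + 1 - 1 = t by ring]
  linarith

lemma le_Bfun {H : ℝ} (hH : 1 / 2 < H) (hH1 : H < 1) (n s : ℕ) :
    n * (H * (2 * H - 1) * ((n : ℝ) + s) ^ (2 * H - 2)) ≤ Bfun H n s := by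
  have h := Finset.card_nsmul_le_sum (Finset.Ico s (n + s)) (covb H)
    (H * (2 * H - 1) * ((n : ℝ) + s) ^ (2 * H - 2)) fun i hi => by
      refine le_trans (mul_le_mul_of_nonneg_left ?_
        (mul_nonneg (by linarith) (by linarith))) (le_covb hH hH1 i)
      refine rpow_le_rpow_of_nonpos (by positivity) ?_ (by linarith)
      exact_mod_cast (Finset.mem_Ico.1 hi).2
  simpa [Bfun] using h

/-- The increments of `x (x + s) ^ (-a)` dominate `(1 - a) (x + 1 + s) ^ (-a)`. -/
lemma one_sub_mul_rpow_neg_le_increment {a x s : ℝ} (ha : 0 ≤ a) (ha1 : a ≤ 1) (hx : 0 ≤ x)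
    (hs : 0 < s) :
    (1 - a) * (x + 1 + s) ^ (-a) ≤ (x + 1) * (x + 1 + s) ^ (-a) - x * (x + s) ^ (-a) := by
  have hxs : 0 < x + s := by linarith
  have hxs' : 0 < x + 1 + s := by linarith
  have hbern : (1 + 1 / (x + s)) ^ a ≤ 1 + a * (1 / (x + s)) :=
    rpow_one_add_le_one_add_mul_self (by linarith [one_div_pos.2 hxs]) ha ha1
  have hsplit : (x + s) ^ (-a) = (1 + 1 / (x + s)) ^ a * (x + 1 + s) ^ (-a) := by
    rw [show 1 + 1 / (x + s) = (x + 1 + s) / (x + s) by field_simp; ring,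
      div_rpow hxs'.le hxs.le, rpow_neg hxs.le, rpow_neg hxs'.le]
    have := (rpow_pos_of_pos hxs' a).ne'
    field_simp
  have hle : x * (1 + 1 / (x + s)) ^ a ≤ x + a := by
    refine (mul_le_mul_of_nonneg_left hbern hx).trans ?_
    have : x / (x + s) ≤ 1 := (div_le_one hxs).2 (by linarith)
    calc x * (1 + a * (1 / (x + s))) = x + a * (x / (x + s)) := by ring
      _ ≤ x + a := by nlinarith
  rw [hsplit]
  nlinarith [mul_le_mul_of_nonneg_right hle (rpow_pos_of_pos hxs' (-a)).le]

lemma Bfun_le {H : ℝ} (hH : 3 / 4 < H) (hH1 : H < 1) (n s : ℕ) (hs : 3 ≤ s) :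
    Bfun H n s ≤ 4 * (H * (2 * H - 1)) * (n * ((n : ℝ) + s) ^ (2 * H - 2)) := by
  have hC : 0 ≤ H * (2 * H - 1) := mul_nonneg (by linarith) (by linarith)
  have hs' : (3 : ℝ) ≤ s := by exact_mod_cast hs
  induction n with
  | zero => simp [Bfun]
  | succ n ih =>
    have hn : (0 : ℝ) ≤ n := n.cast_nonneg
    have hsucc : Bfun H (n + 1) s = Bfun H n s + covb H (n + s) := by
      rw [Bfun, Bfun, show n + 1 + s = n + s + 1 by ring, Finset.sum_Ico_succ_top (by omega)]
    have hb := covb_le (by linarith) hH1 (n + s) (by omega)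
    have hinc := one_sub_mul_rpow_neg_le_increment (a := 2 - 2 * H) (by linarith)
      (by linarith) hn (show (0 : ℝ) < s by linarith)
    rw [show -(2 - 2 * H) = 2 * H - 2 by ring] at hinc
    have hpos : 0 < ((n : ℝ) + 1 + s) ^ (2 * H - 2) := rpow_pos_of_pos (by linarith) _
    have hshift : ((n : ℝ) + s - 1) ^ (2 * H - 2) ≤ 2 * ((n : ℝ) + 1 + s) ^ (2 * H - 2) := by
      have hhalf : (1 / 2 : ℝ) ^ (2 * H - 2) ≤ 2 := by
        rw [one_div, inv_rpow zero_le_two, ← rpow_neg zero_le_two]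
        simpa using rpow_le_rpow_of_exponent_le (one_le_two (α := ℝ))
          (show -(2 * H - 2) ≤ 1 by linarith)
      calc ((n : ℝ) + s - 1) ^ (2 * H - 2) ≤ (1 / 2 * ((n : ℝ) + 1 + s)) ^ (2 * H - 2) :=
            rpow_le_rpow_of_nonpos (by linarith) (by linarith) (by linarith)
        _ = (1 / 2 : ℝ) ^ (2 * H - 2) * ((n : ℝ) + 1 + s) ^ (2 * H - 2) :=
            mul_rpow (by norm_num) (by linarith)
        _ ≤ _ := mul_le_mul_of_nonneg_right hhalf hpos.le
    have hstep : ((n : ℝ) + s - 1) ^ (2 * H - 2) ≤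
        4 * (((n : ℝ) + 1) * ((n : ℝ) + 1 + s) ^ (2 * H - 2)
          - n * ((n : ℝ) + s) ^ (2 * H - 2)) := by nlinarith
    have hmul := mul_le_mul_of_nonneg_left hstep hC
    rw [hsucc]
    push_cast at hb ⊢
    linarith

lemma le_Bfun_div_Bfun {H : ℝ} (hH : 3 / 4 < H) (hH1 : H < 1) {n k i s : ℕ} (hn : 1 ≤ n)
    (hnk : n ≤ k) (hik : i ≤ k) (hs : 3 ≤ s) :
    1 / 8 * (((n : ℝ) + s) / k) ^ (2 - 2 * H) ≤ Bfun H n i / Bfun H n s := by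
  have hC : 0 < H * (2 * H - 1) := mul_pos (by linarith) (by linarith)
  have hn' : (0 : ℝ) < n := by exact_mod_cast hn
  have hk' : (0 : ℝ) < k := by exact_mod_cast hn.trans hnk
  have hns : (0 : ℝ) < (n : ℝ) + s := by positivity
  have hBs : 0 < Bfun H n s := lt_of_lt_of_le (by positivity) (le_Bfun (by linarith) hH1 n s)
  have hni : ((n : ℝ) + i) ≤ 2 * k := by
    have h : n + i ≤ 2 * k := by omega
    exact_mod_cast h
  have htwo : (1 / 2 : ℝ) ≤ 2 ^ (2 * H - 2) := by
    have := rpow_le_rpow_of_exponent_le (one_le_two (α := ℝ)) (show -1 ≤ 2 * H - 2 by linarith)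
    rwa [rpow_neg_one, ← one_div] at this
  have hpow : 1 / 2 * (k : ℝ) ^ (2 * H - 2) ≤ ((n : ℝ) + i) ^ (2 * H - 2) :=
    calc 1 / 2 * (k : ℝ) ^ (2 * H - 2) ≤ 2 ^ (2 * H - 2) * (k : ℝ) ^ (2 * H - 2) :=
          mul_le_mul_of_nonneg_right htwo (by positivity)
      _ = (2 * (k : ℝ)) ^ (2 * H - 2) := (mul_rpow zero_le_two hk'.le).symm
      _ ≤ _ := rpow_le_rpow_of_nonpos (by positivity) hni (by linarith)
  have hratio : (((n : ℝ) + s) / k) ^ (2 - 2 * H) * ((n : ℝ) + s) ^ (2 * H - 2)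
      = (k : ℝ) ^ (2 * H - 2) := by
    rw [div_rpow hns.le hk'.le, div_mul_eq_mul_div, ← rpow_add hns,
      show 2 * H - 2 = -(2 - 2 * H) by ring, rpow_neg hk'.le]
    simp
  rw [le_div_iff₀ hBs]
  calc 1 / 8 * (((n : ℝ) + s) / k) ^ (2 - 2 * H) * Bfun H n s
      ≤ 1 / 8 * (((n : ℝ) + s) / k) ^ (2 - 2 * H) *
          (4 * (H * (2 * H - 1)) * (n * ((n : ℝ) + s) ^ (2 * H - 2))) :=
        mul_le_mul_of_nonneg_left (Bfun_le hH hH1 n s hs) (by positivity)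
    _ = n * (H * (2 * H - 1) * (1 / 2 * (k : ℝ) ^ (2 * H - 2))) := by
        rw [← hratio]; ring
    _ ≤ n * (H * (2 * H - 1) * ((n : ℝ) + i) ^ (2 * H - 2)) := by gcongr
    _ ≤ Bfun H n i := le_Bfun (by linarith) hH1 n i

/-- Lower bound on `q(s)` (from the proof of Lemma 2.4): for fixed `m > 0` there is a
constant `K > 0` depending only on `H` such that for all `n ≥ 1`, all sufficiently large
`k`, and all `s` with `4 ≤ s ≤ k - 2`, `q(s) ≥ (K/m) ((n+s)/k)^{2-2H}`. -/
theorem qfun_lower_bound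
    (H : ℝ) (hH : 3/4 < H) (hH1 : H < 1) (m : ℝ) (hm : 0 < m) :
    ∃ K : ℝ, 0 < K ∧ ∀ n : ℕ, 1 ≤ n → ∃ k₀ : ℕ, ∀ k : ℕ, k₀ ≤ k →
      ∀ s : ℕ, 4 ≤ s → s + 2 ≤ k →
        (K / m) * (((n : ℝ) + (s : ℝ)) / (k : ℝ)) ^ (2 - 2 * H) ≤ qfun H n k m s := by
  have hC : 0 < H * (2 * H - 1) := mul_pos (by linarith) (by linarith)
  refine ⟨H * (2 * H - 1) / 8, by positivity, fun n hn => ⟨n, fun k hnk s hs hsk => ?_⟩⟩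
  have hk : (0 : ℝ) < k := by exact_mod_cast hn.trans hnk
  set R := (((n : ℝ) + s) / k) ^ (2 - 2 * H)
  have hR : 0 ≤ R := by positivity
  have hsum := Finset.card_nsmul_le_sum (Finset.Icc 1 k)
    (fun i => Bfun H n i / Bfun H n s * covb H (Nat.dist i s))
    (1 / 8 * R * (H * (2 * H - 1) * (k : ℝ) ^ (2 * H - 2))) fun i hi => by
      obtain ⟨hi₁, hik⟩ := Finset.mem_Icc.1 hi
      have hratio : 1 / 8 * R ≤ Bfun H n i / Bfun H n s :=
        le_Bfun_div_Bfun hH hH1 hn hnk hik (by omega)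
      have hdist : Nat.dist i s + 1 ≤ k := by unfold Nat.dist; omega
      have hb : H * (2 * H - 1) * (k : ℝ) ^ (2 * H - 2) ≤ covb H (Nat.dist i s) := by
        refine le_trans (mul_le_mul_of_nonneg_left ?_ hC.le) (le_covb (by linarith) hH1 _)
        exact rpow_le_rpow_of_nonpos (by positivity) (by exact_mod_cast hdist) (by linarith)
      exact mul_le_mul hratio hb (by positivity) (le_trans (by positivity) hratio)
  have hkpow : (k : ℝ) * (k : ℝ) ^ (2 * H - 2) = (k : ℝ) ^ (2 * H - 1) := by
    rw [← rpow_one_add' hk.le (by linarith)]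
    ring_nf
  have hpos : 0 < (k : ℝ) ^ (2 * H - 1) := rpow_pos_of_pos hk _
  rw [Nat.card_Icc, add_tsub_cancel_right, nsmul_eq_mul] at hsum
  unfold qfun
  calc H * (2 * H - 1) / 8 / m * R
      = 1 / (m * (k : ℝ) ^ (2 * H - 1)) *
          (k * (1 / 8 * R * (H * (2 * H - 1) * (k : ℝ) ^ (2 * H - 2)))) := by
        rw [show (k : ℝ) * (1 / 8 * R * (H * (2 * H - 1) * (k : ℝ) ^ (2 * H - 2)))
          = 1 / 8 * R * (H * (2 * H - 1)) * (k * (k : ℝ) ^ (2 * H - 2)) by ring, hkpow]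
        field_simp
    _ ≤ _ := mul_le_mul_of_nonneg_left hsum (by positivity)
end
end

section
/- (Theorem 3.1, part 1.) The skew product T̃ : Ω × ℝ → Ω × ℝ, T̃(ω, r) = (Tω, r + ω₁), is a measure-preserving transformation of (Ω × ℝ, μ) with μ = P ⊗ Leb, and T̃ is conservative: for every measurable A ⊆ Ω × ℝ with μ(A) > 0, one has μ( A \ ⋃_{n≥1} T̃^{−n} A ) = 0. -/
open MeasureTheory ProbabilityTheory Filter Matrix Real

noncomputable section

/-- The shift `T` on `Ω = ℝ^ℕ`: `(Tω)_i = ω_{i+1}`. -/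
def shiftMap : (ℕ → ℝ) → (ℕ → ℝ) := fun ω i => ω (i + 1)

/-- The skew product `T̃(ω, r) = (Tω, r + ω₀)` on `Ω × ℝ`. -/
def skewProd : (ℕ → ℝ) × ℝ → (ℕ → ℝ) × ℝ := fun p => (shiftMap p.1, p.2 + p.1 0)

open scoped Topology

/-- **Cramér–Wold** for measures on `ℝ^ℕ`. -/
theorem measure_eq_of_map_sum_eq {μ ν : Measure (ℕ → ℝ)} [IsFiniteMeasure μ] [IsFiniteMeasure ν]
    (h : ∀ (n : ℕ) (c : Fin n → ℝ),
      μ.map (fun ω => ∑ i, c i * ω i.1) = ν.map (fun ω => ∑ i, c i * ω i.1)) : μ = ν := by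
  refine IsProjectiveLimit.unique (P := fun I => ν.map I.restrict) (fun I => ?_) (fun I => rfl)
  refine Measure.ext_of_charFunDual (ν := ν.map I.restrict) ?_
  ext L
  classical
  obtain ⟨n, hn⟩ : ∃ n, I ⊆ Finset.range n := I.exists_nat_subset_range
  let c : ℕ → ℝ := fun i => if hi : i ∈ I then L (Pi.single ⟨i, hi⟩ 1) else 0
  have hL : (L ∘ I.restrict : (ℕ → ℝ) → ℝ) = fun ω => ∑ i : Fin n, c i * ω i.1 := by
    funext ω
    have h1 : L (I.restrict ω) = ∑ i : I, c i * ω i := by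
      conv_lhs => rw [← Finset.univ_sum_single (I.restrict ω), map_sum]
      refine Finset.sum_congr rfl fun i _ => ?_
      have : (Pi.single i (I.restrict ω i) : I → ℝ) = ω i • Pi.single i (1 : ℝ) := by
        rw [← Pi.single_smul]; simp
      rw [this, map_smul]
      simp [c, mul_comm]
    rw [Function.comp_apply, h1, Fin.sum_univ_eq_sum_range (fun i => c i * ω i) n,
      Finset.sum_coe_sort I (fun i => c i * ω i)]
    refine Finset.sum_subset hn fun i _ hi => ?_
    simp [c, hi]
  have hmap (ρ : Measure (ℕ → ℝ)) :
      (ρ.map I.restrict).map L = ρ.map (fun ω => ∑ i : Fin n, c i * ω i.1) := by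
    rw [← hL]
    exact Measure.map_map L.continuous.measurable (Finset.measurable_restrict I)
  rw [charFunDual_eq_charFun_map_one, charFunDual_eq_charFun_map_one]
  exact congrArg (charFun · 1) ((hmap μ).trans ((h n fun i => c i).trans (hmap ν).symm))

theorem measurable_shiftMap : Measurable shiftMap :=
  measurable_pi_lambda _ fun i => measurable_pi_apply (i + 1)

/-- A centered Gaussian measure on `ℝ^ℕ` with Toeplitz covariance is shift-invariant. -/
theorem measurePreserving_shiftMap {b : ℕ → ℝ} {P : Measure (ℕ → ℝ)} [IsProbabilityMeasure P]
    (hGauss : ∀ n : ℕ, ∀ c : Fin n → ℝ,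
      Measure.map (fun ω => ∑ i, c i * ω i.1) P =
        gaussianReal 0 (∑ i, ∑ j, c i * c j * b (Nat.dist i.1 j.1)).toNNReal) :
    MeasurePreserving shiftMap P P := by
  refine ⟨measurable_shiftMap, ?_⟩
  have := Measure.isProbabilityMeasure_map (μ := P) measurable_shiftMap.aemeasurable
  refine measure_eq_of_map_sum_eq fun n c => ?_
  rw [Measure.map_map (by fun_prop) measurable_shiftMap, hGauss n c]
  have h := hGauss (n + 1) (Fin.cons 0 c)
  simp only [Fin.sum_univ_succ, Fin.cons_zero, Fin.cons_succ, Fin.val_succ, zero_mul, mul_zero,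
    Finset.sum_const_zero, zero_add, Nat.dist_add_add_right] at h
  exact h

/-- The skew product over a shift-invariant measure preserves the product with Lebesgue measure. -/
theorem measurePreserving_skewProd {P : Measure (ℕ → ℝ)} [SFinite P]
    (h : MeasurePreserving shiftMap P P) :
    MeasurePreserving skewProd (P.prod volume) (P.prod volume) :=
  h.skew_product (g := fun ω r => r + ω 0) (by unfold Function.uncurry; fun_prop)
    (ae_of_all _ fun ω => map_add_right_eq_self volume (ω 0))

theorem skewProd_iterate_snd (n : ℕ) (p : (ℕ → ℝ) × ℝ) :
    (skewProd^[n] p).2 = p.2 + ∑ i ∈ Finset.range n, p.1 i := by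
  have key : skewProd^[n] p = (fun i => p.1 (i + n), p.2 + ∑ i ∈ Finset.range n, p.1 i) := by
    induction n with
    | zero => simp
    | succ n ih =>
      rw [Function.iterate_succ_apply', ih]
      ext <;> simp [skewProd, shiftMap, Finset.sum_range_succ, add_assoc, add_comm 1 n]
  rw [key]

/-- The part of a skew strip lying over a base set `E`. -/
theorem prod_volume_strip_over {α : Type*} [MeasurableSpace α] (P : Measure α)
    [IsFiniteMeasure P] {f : α → ℝ} (hf : Measurable f) {E : Set α} (hE : MeasurableSet E) {M : ℝ}
    (hM : 0 ≤ M) :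
    (P.prod volume).real {p : α × ℝ | p.1 ∈ E ∧ |p.2 + f p.1| ≤ M} = 2 * M * P.real E := by
  have hmeas : MeasurableSet {p : α × ℝ | p.1 ∈ E ∧ |p.2 + f p.1| ≤ M} :=
    (measurable_fst hE).inter (measurableSet_le
      ((measurable_snd.add (hf.comp measurable_fst)).abs) measurable_const)
  have hsec : ∀ a, volume (Prod.mk a ⁻¹' {p : α × ℝ | p.1 ∈ E ∧ |p.2 + f p.1| ≤ M}) =
      E.indicator (fun _ => ENNReal.ofReal (2 * M)) a := by
    intro a
    by_cases ha : a ∈ E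
    · have : Prod.mk a ⁻¹' {p : α × ℝ | p.1 ∈ E ∧ |p.2 + f p.1| ≤ M} =
          Set.Icc (-M - f a) (M - f a) := by
        ext r
        simp only [Set.mem_preimage, Set.mem_ofPred_eq, ha, true_and, abs_le, Set.mem_Icc]
        constructor <;> rintro ⟨h1, h2⟩ <;> constructor <;> linarith
      rw [this, Real.volume_Icc, Set.indicator_of_mem ha]
      congr 1; ring
    · simp [ha]
  rw [measureReal_def, Measure.prod_apply hmeas]
  simp_rw [hsec]
  rw [lintegral_indicator hE, setLIntegral_const, ENNReal.toReal_mul,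
    ENNReal.toReal_ofReal (by positivity), measureReal_def]

/-- If the partial sums satisfy a weak law of large numbers, uniformly up to time `N`, then the
skew product has no wandering set of positive measure with bounded second coordinate. -/
theorem measure_eq_zero_of_wandering_of_bounded {P : Measure (ℕ → ℝ)} [IsProbabilityMeasure P]
    (hT : MeasurePreserving skewProd (P.prod volume) (P.prod volume))
    (hS : ∀ ε > 0, ∀ δ > 0, ∀ᶠ N : ℕ in atTop, ∀ n < N,
      P.real {ω | ε * N ≤ |∑ i ∈ Finset.range n, ω i|} ≤ δ)
    {W : Set ((ℕ → ℝ) × ℝ)} (hW : MeasurableSet W) {M : ℝ} (hM : 0 < M)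
    (hbdd : ∀ p ∈ W, |p.2| ≤ M) (hwand : ∀ n ≠ 0, ∀ p ∈ W, skewProd^[n] p ∉ W) :
    P.prod volume W = 0 := by
  set μ := P.prod (volume : Measure ℝ)
  have strip (R : ℝ) (hR : 0 ≤ R) : μ.real {p : (ℕ → ℝ) × ℝ | |p.2| ≤ R} = 2 * R := by
    simpa using prod_volume_strip_over P (f := fun _ => 0) measurable_const MeasurableSet.univ hR
  have strip_ne_top (R : ℝ) : μ {p : (ℕ → ℝ) × ℝ | |p.2| ≤ R} ≠ ⊤ := by
    rcases le_or_gt R 0 with hR | hR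
    · refine measure_ne_top_of_subset (s := {p | |p.2| ≤ 1}) ?_ ?_
      · intro p hp; exact le_trans hp (hR.trans zero_le_one)
      · intro h; have := strip 1 zero_le_one; simp [measureReal_def, h] at this
    · intro h; have := strip R hR.le; simp [measureReal_def, h] at this; linarith
  have hWfin : μ W ≠ ⊤ := measure_ne_top_of_subset hbdd (strip_ne_top M)
  by_contra h0
  set w := μ.real W with hw
  have hw0 : 0 < w := ENNReal.toReal_pos h0 hWfin
  have hTn (n : ℕ) : MeasurePreserving skewProd^[n] μ μ := hT.iterate n
  have hpre (n : ℕ) : MeasurableSet (skewProd^[n] ⁻¹' W) := (hTn n).measurable hW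
  have hdisj : Pairwise (Function.onFun Disjoint fun n => skewProd^[n] ⁻¹' W) := by
    have aux (m k : ℕ) (hk : k ≠ 0) :
        Disjoint (skewProd^[m] ⁻¹' W) (skewProd^[m + k] ⁻¹' W) := by
      refine Set.disjoint_left.2 fun p hp hp' => hwand k hk _ hp ?_
      rwa [← Function.iterate_add_apply, add_comm]
    intro m n hmn
    rcases lt_or_gt_of_ne hmn with h | h
    · obtain ⟨k, rfl⟩ := Nat.exists_eq_add_of_lt h
      exact aux m (k + 1) (by simp)
    · obtain ⟨k, rfl⟩ := Nat.exists_eq_add_of_lt h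
      exact (aux n (k + 1) (by simp)).symm
  obtain ⟨N, hN, hNM⟩ := ((hS (w / 8) (by positivity) (w / (8 * M)) (by positivity)).and
    (tendsto_natCast_atTop_atTop.eventually_gt_atTop (8 * M / w))).exists
  have hN0 : (0 : ℝ) < N := lt_trans (by positivity) hNM
  set R := w / 8 * N + M with hR
  have hR0 : 0 ≤ R := by positivity
  have lower (n : ℕ) (hn : n < N) : 3 / 4 * w ≤ μ.real (skewProd^[n] ⁻¹' W ∩ {p | |p.2| ≤ R}) := by
    set E := {ω : ℕ → ℝ | w / 8 * N ≤ |∑ i ∈ Finset.range n, ω i|}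
    have hE : MeasurableSet E := measurableSet_le measurable_const (by fun_prop)
    have hstrip := prod_volume_strip_over P (f := fun ω => ∑ i ∈ Finset.range n, ω i)
      (by fun_prop) hE hM.le
    have hsub : skewProd^[n] ⁻¹' W ⊆ (skewProd^[n] ⁻¹' W ∩ {p | |p.2| ≤ R}) ∪
        {p | p.1 ∈ E ∧ |p.2 + ∑ i ∈ Finset.range n, p.1 i| ≤ M} := by
      intro p hp
      have hb := hbdd _ hp
      rw [skewProd_iterate_snd] at hb
      by_cases hpE : p.1 ∈ E
      · exact Or.inr ⟨hpE, hb⟩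
      · refine Or.inl ⟨hp, ?_⟩
        have hlt : |∑ i ∈ Finset.range n, p.1 i| < w / 8 * N := not_le.1 hpE
        have := abs_sub (p.2 + ∑ i ∈ Finset.range n, p.1 i) (∑ i ∈ Finset.range n, p.1 i)
        rw [add_sub_cancel_right] at this
        show |p.2| ≤ R
        linarith
    have hfin : μ {p | p.1 ∈ E ∧ |p.2 + ∑ i ∈ Finset.range n, p.1 i| ≤ M} ≠ ⊤ := by
      refine measure_ne_top_of_subset
        (s := skewProd^[n] ⁻¹' {p | |p.2| ≤ M}) (fun p hp => ?_) ?_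
      · simpa [skewProd_iterate_snd] using hp.2
      · rw [(hTn n).measure_preimage
          (measurableSet_le (by fun_prop) measurable_const).nullMeasurableSet]
        exact strip_ne_top M
    have h1 : w = μ.real (skewProd^[n] ⁻¹' W) := by
      rw [measureReal_def, (hTn n).measure_preimage hW.nullMeasurableSet, hw, measureReal_def]
    have h2 := measureReal_mono (μ := μ) hsub (measure_union_ne_top
      (measure_ne_top_of_subset Set.inter_subset_right (strip_ne_top R)) hfin)
    have h3 := h2.trans (measureReal_union_le _ _)
    rw [← h1, hstrip] at h3
    have h4 : 2 * M * P.real E ≤ 2 * M * (w / (8 * M)) := by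
      gcongr; exact hN n hn
    have h5 : 2 * M * (w / (8 * M)) = w / 4 := by field_simp; norm_num
    linarith
  have upper : ∑ n ∈ Finset.range N, μ.real (skewProd^[n] ⁻¹' W ∩ {p | |p.2| ≤ R}) ≤ 2 * R := by
    rw [← strip R hR0, ← measureReal_biUnion_finset
      (h := fun n _ => measure_ne_top_of_subset Set.inter_subset_right (strip_ne_top R))]
    · exact measureReal_mono (Set.iUnion₂_subset fun _ _ => Set.inter_subset_right)
        (strip_ne_top R)
    · intro m _ n _ hmn
      exact (hdisj hmn).mono Set.inter_subset_left Set.inter_subset_left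
    · exact fun n _ => (hpre n).inter (measurableSet_le (by fun_prop) measurable_const)
  have hsum := (Finset.sum_le_sum fun n hn => lower n (Finset.mem_range.1 hn)).trans upper
  rw [Finset.sum_const, Finset.card_range, nsmul_eq_mul] at hsum
  rw [div_lt_iff₀ hw0] at hNM
  nlinarith

/-- Under the same weak law of large numbers, the skew product is conservative. -/
theorem measure_diff_iUnion_preimage_skewProd_eq_zero {P : Measure (ℕ → ℝ)}
    [IsProbabilityMeasure P]
    (hT : MeasurePreserving skewProd (P.prod volume) (P.prod volume))
    (hS : ∀ ε > 0, ∀ δ > 0, ∀ᶠ N : ℕ in atTop, ∀ n < N,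
      P.real {ω | ε * N ≤ |∑ i ∈ Finset.range n, ω i|} ≤ δ)
    {A : Set ((ℕ → ℝ) × ℝ)} (hA : MeasurableSet A) :
    P.prod volume (A \ ⋃ n ∈ {n : ℕ | 1 ≤ n}, skewProd^[n] ⁻¹' A) = 0 := by
  set B := A \ ⋃ n ∈ {n : ℕ | 1 ≤ n}, skewProd^[n] ⁻¹' A
  have hBm : MeasurableSet B :=
    hA.diff (MeasurableSet.biUnion (Set.to_countable _) fun n _ => (hT.iterate n).measurable hA)
  have hcover : B ⊆ ⋃ k : ℕ, B ∩ {p | |p.2| ≤ k + 1} := by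
    intro p hp
    obtain ⟨k, hk⟩ := exists_nat_ge |p.2|
    exact Set.mem_iUnion.2 ⟨k, hp, hk.trans (by linarith)⟩
  refine measure_mono_null hcover (measure_iUnion_null fun k => ?_)
  refine measure_eq_zero_of_wandering_of_bounded hT hS
    (hBm.inter (measurableSet_le (by fun_prop) measurable_const))
    (M := k + 1) (by positivity) (fun p hp => hp.2) fun n hn p hp hp' => hp.1.2 ?_
  exact Set.mem_biUnion (show 1 ≤ n from Nat.one_le_iff_ne_zero.2 hn) hp'.1.1

theorem two_mul_sum_covb {H : ℝ} (hH : 0 < H) (n : ℕ) :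
    2 * ∑ t ∈ Finset.range n, covb H (t + 1) =
      ((n : ℝ) + 1) ^ (2 * H) - (n : ℝ) ^ (2 * H) - 1 := by
  induction n with
  | zero => simp [Real.zero_rpow (by positivity : 2 * H ≠ 0)]
  | succ n ih =>
    rw [Finset.sum_range_succ, mul_add, ih, covb]
    push_cast
    rw [show (n : ℝ) + 1 + 1 = n + 2 by ring]
    ring

/-- The `n`-th partial sum of fractional Gaussian noise has variance `n ^ (2H)`. -/
theorem sum_sum_covb {H : ℝ} (hH : 0 < H) (n : ℕ) :
    ∑ i ∈ Finset.range n, ∑ j ∈ Finset.range n, covb H (Nat.dist i j) = (n : ℝ) ^ (2 * H) := by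
  induction n with
  | zero => simp [Real.zero_rpow (by positivity : 2 * H ≠ 0)]
  | succ n ih =>
    have hrow : ∑ i ∈ Finset.range n, covb H (Nat.dist i n) =
        ∑ t ∈ Finset.range n, covb H (t + 1) := by
      rw [← Finset.sum_range_reflect]
      refine Finset.sum_congr rfl fun i hi => ?_
      have := Finset.mem_range.1 hi
      congr 1
      rw [Nat.dist_eq_sub_of_le (by omega)]
      omega
    have hcol : ∑ j ∈ Finset.range n, covb H (Nat.dist n j) =
        ∑ t ∈ Finset.range n, covb H (t + 1) := by
      simp_rw [Nat.dist_comm n, hrow]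
    simp_rw [Finset.sum_range_succ, Finset.sum_add_distrib]
    rw [ih, hrow, hcol, Nat.dist_self, covb]
    have := two_mul_sum_covb hH n
    push_cast
    linarith

/-- Chebyshev's inequality for the partial sums of fractional Gaussian noise. -/
theorem measureReal_le_abs_partial_sum_le {H : ℝ} (hH : 0 < H)
    {P : Measure (ℕ → ℝ)} [IsProbabilityMeasure P]
    (hGauss : ∀ n : ℕ, ∀ c : Fin n → ℝ,
      Measure.map (fun ω => ∑ i, c i * ω i.1) P =
        gaussianReal 0 (∑ i, ∑ j, c i * c j * covb H (Nat.dist i.1 j.1)).toNNReal)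
    (n : ℕ) {a : ℝ} (ha : 0 < a) :
    P.real {ω | a ≤ |∑ i ∈ Finset.range n, ω i|} ≤ (n : ℝ) ^ (2 * H) / a ^ 2 := by
  have hlaw : P.map (fun ω => ∑ i ∈ Finset.range n, ω i) =
      gaussianReal 0 ((n : ℝ) ^ (2 * H)).toNNReal := by
    have h := hGauss n fun _ => 1
    simp only [one_mul] at h
    simp_rw [fun i : Fin n => Fin.sum_univ_eq_sum_range (fun j => covb H (Nat.dist i.1 j)) n] at h
    rw [Fin.sum_univ_eq_sum_range
      (fun i => ∑ j ∈ Finset.range n, covb H (Nat.dist i j)) n, sum_sum_covb hH] at h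
    rw [← h]
    congr 1
    funext ω
    exact (Fin.sum_univ_eq_sum_range (fun i => ω i) n).symm
  have hcheb := meas_ge_le_variance_div_sq
    (memLp_id_gaussianReal (μ := 0) (v := ((n : ℝ) ^ (2 * H)).toNNReal) 2) ha
  rw [variance_id_gaussianReal, Real.coe_toNNReal _ (by positivity)] at hcheb
  simp only [id, integral_id_gaussianReal, sub_zero] at hcheb
  rw [← hlaw, Measure.map_apply (by fun_prop)
    (measurableSet_le measurable_const (by fun_prop))] at hcheb
  exact ENNReal.toReal_le_of_le_ofReal (by positivity) hcheb

/-- Weak law of large numbers for fractional Gaussian noise, uniformly up to time `N`. -/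
theorem eventually_forall_measureReal_partial_sum_le {H : ℝ} (hH : 0 < H) (hH1 : H < 1)
    {P : Measure (ℕ → ℝ)} [IsProbabilityMeasure P]
    (hGauss : ∀ n : ℕ, ∀ c : Fin n → ℝ,
      Measure.map (fun ω => ∑ i, c i * ω i.1) P =
        gaussianReal 0 (∑ i, ∑ j, c i * c j * covb H (Nat.dist i.1 j.1)).toNNReal)
    {ε : ℝ} (hε : 0 < ε) {δ : ℝ} (hδ : 0 < δ) :
    ∀ᶠ N : ℕ in atTop, ∀ n < N,
      P.real {ω | ε * N ≤ |∑ i ∈ Finset.range n, ω i|} ≤ δ := by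
  have hlim : Tendsto (fun N : ℕ => (N : ℝ) ^ (-(2 - 2 * H))) atTop (𝓝 0) :=
    (tendsto_rpow_neg_atTop (by linarith)).comp tendsto_natCast_atTop_atTop
  filter_upwards [hlim.eventually_le_const (show 0 < δ * ε ^ 2 by positivity),
    eventually_gt_atTop 0] with N hN hN0 n hn
  have hN0' : (0 : ℝ) < N := by exact_mod_cast hN0
  refine (measureReal_le_abs_partial_sum_le hH hGauss n (by positivity)).trans ?_
  rw [div_le_iff₀ (by positivity)]
  calc (n : ℝ) ^ (2 * H) ≤ (N : ℝ) ^ (2 * H) := by gcongr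
    _ = (N : ℝ) ^ (-(2 - 2 * H)) * (N : ℝ) ^ 2 := by
      rw [← Real.rpow_natCast, ← Real.rpow_add hN0']
      congr 1; push_cast; ring
    _ ≤ δ * ε ^ 2 * (N : ℝ) ^ 2 := by gcongr
    _ = δ * (ε * N) ^ 2 := by ring

/-- Theorem 3.1, part 1: the skew product `T̃(ω,r) = (Tω, r + ω₀)` preserves the measure
`μ = P ⊗ Leb` on `Ω × ℝ` and is conservative: every measurable `A` with `μ(A) > 0`
satisfies `μ(A \ ⋃_{n ≥ 1} T̃^{-n} A) = 0`. -/
theorem skew_product_measure_preserving_conservative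
    (H : ℝ) (hH : 1/2 < H) (hH1 : H < 1)
    (P : Measure (ℕ → ℝ)) [IsProbabilityMeasure P]
    (hGauss : ∀ n : ℕ, ∀ c : Fin n → ℝ,
      Measure.map (fun ω => ∑ i, c i * ω i.1) P =
        gaussianReal 0 (∑ i, ∑ j, c i * c j * covb H (Nat.dist i.1 j.1)).toNNReal) :
    MeasurePreserving skewProd (P.prod volume) (P.prod volume) ∧
    ∀ A : Set ((ℕ → ℝ) × ℝ), MeasurableSet A → 0 < P.prod volume A →
      P.prod volume (A \ ⋃ n ∈ {n : ℕ | 1 ≤ n}, skewProd^[n] ⁻¹' A) = 0 := by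
  have hH0 : 0 < H := by linarith
  have hT := measurePreserving_skewProd (measurePreserving_shiftMap hGauss)
  exact ⟨hT, fun A hA _ => measure_diff_iUnion_preimage_skewProd_eq_zero hT
    (fun ε hε δ hδ => eventually_forall_measureReal_partial_sum_le hH0 hH1 hGauss hε hδ) hA⟩
end
end
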